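/- arXiv:2204.14208 — 10 statements merged into one kernel-verified Lean document; each statement's English description precedes it below -/
import Mathlib

section
/- For every integer n, there exist infinitely many Diophantine triples with the property D(n) which also have the property D(t) for some integer t with t ≠ n. Precisely, the set of three-element subsets {a, b, c} of ℤ which are D(n)-triples and for which there exists an integer t ≠ n such that {a, b, c} is also a D(t)-triple, is infinite. -/
/-- `{a, b, c}` is a Diophantine triple with the property `D(n)` in `ℤ`:
three pairwise distinct nonzero integers such that `ab + n`, `ac + n`, `bc + n`
are all perfect squares. -/
def IsDTriple (n a b c : ℤ) : Prop :=
  a ≠ b ∧ a ≠ c ∧ b ≠ c ∧ a ≠ 0 ∧ b ≠ 0 ∧ c ≠ 0 ∧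
    IsSquare (a * b + n) ∧ IsSquare (a * c + n) ∧ IsSquare (b * c + n)

/-- A `D(n)`-triple of even sum which is not regular is also a `D(t)`-triple for
`t = (a² + b² + c² - 2ab - 2ac - 2bc) / 4`, and this `t` differs from `n`. -/
theorem IsDTriple.exists_ne {n a b c : ℤ} (h : IsDTriple n a b c) (heven : Even (a + b + c))
    (hreg : (a + b - c) ^ 2 ≠ 4 * (a * b + n)) : ∃ t : ℤ, t ≠ n ∧ IsDTriple t a b c := by
  obtain ⟨m, hm⟩ := heven
  obtain ⟨hab, hac, hbc, ha, hb, hc, -⟩ := h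
  obtain rfl : a = 2 * m - b - c := by linarith
  refine ⟨(m - c) ^ 2 - (2 * m - b - c) * b, ?_, hab, hac, hbc, ha, hb, hc,
    ⟨m - c, by ring⟩, ⟨m - b, by ring⟩, ⟨b + c - m, by ring⟩⟩
  rintro rfl
  exact hreg (by ring)

/-- A set of finite sets of integers whose members contain arbitrarily large integers is
infinite. -/
theorem Set.infinite_of_forall_exists_lt_mem {A : Set (Finset ℤ)}
    (h : ∀ N : ℤ, ∃ S ∈ A, ∃ x ∈ S, N < x) : A.Infinite := by
  intro hA
  obtain ⟨N, hN⟩ := (hA.toFinset.biUnion id).bddAbove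
  obtain ⟨S, hS, x, hx, hlt⟩ := h N
  have hmem : x ∈ hA.toFinset.biUnion id :=
    Finset.mem_biUnion.2 ⟨S, hA.mem_toFinset.2 hS, hx⟩
  exact absurd (hN (Finset.mem_coe.2 hmem)) (not_le.2 hlt)

/-- There are irregular `D(0)`-triples of even sum with arbitrarily large largest element. -/
theorem exists_irregular_DTriple_zero (N : ℤ) :
    ∃ a b c : ℤ, N < c ∧ IsDTriple 0 a b c ∧ Even (a + b + c) ∧
      (a + b - c) ^ 2 ≠ 4 * (a * b + 0) := by
  obtain ⟨j, hj, hN⟩ : ∃ j : ℤ, 3 ≤ j ∧ N ≤ j :=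
    ⟨max 3 N, le_max_left _ _, le_max_right _ _⟩
  have hc : 9 < j ^ 2 * 4 - 16 := by nlinarith
  refine ⟨1, 9, 4 * j ^ 2, by nlinarith, ⟨by norm_num, by lia, by lia, by norm_num, by norm_num,
    by lia, ⟨3, by norm_num⟩, ⟨2 * j, by ring⟩, ⟨6 * j, by ring⟩⟩, ⟨5 + 2 * j ^ 2, by ring⟩, ?_⟩
  nlinarith

/-- For `n ≠ 0` there are irregular `D(n)`-triples of even sum with arbitrarily large largest
element. With `r = nk`, the pair `{1, r² - n}` is extended by means of the Pell unit
`2nk² - 1 + 2k√(r² - n)`. -/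
theorem exists_irregular_DTriple {n : ℤ} (hn : n ≠ 0) (N : ℤ) :
    ∃ a b c : ℤ, N < c ∧ IsDTriple n a b c ∧ Even (a + b + c) ∧
      (a + b - c) ^ 2 ≠ 4 * (a * b + n) := by
  obtain ⟨j, hj, hjN, hjn⟩ : ∃ j : ℤ, 2 ≤ j ∧ N ≤ j ∧ |n| + 2 ≤ j :=
    ⟨max 2 (max N (|n| + 2)), by simp, by simp, by simp⟩
  obtain ⟨k, hk⟩ : ∃ k : ℤ, k = n * j := ⟨_, rfl⟩
  obtain ⟨r, hr⟩ : ∃ r : ℤ, r = n * k := ⟨_, rfl⟩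
  have hrj : j ≤ r := by
    have : 1 ≤ n ^ 2 := by have := sq_pos_of_ne_zero hn; lia
    rw [hr, hk]; nlinarith
  have hk0 : k ≠ 0 := by rw [hk]; exact mul_ne_zero hn (by lia)
  obtain ⟨s, hs⟩ : ∃ s : ℤ, s = 4 * r * (r + 1) * k - 3 * r - 1 := ⟨_, rfl⟩
  have hs2 : (r + 1) ^ 2 < s ^ 2 := by
    apply sq_lt_sq.2
    rw [abs_of_pos (by lia : 0 < r + 1)]
    have hpos : 0 < 4 * r * (r + 1) := by nlinarith
    rcases lt_or_gt_of_ne hk0 with h | h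
    · refine lt_of_lt_of_le ?_ (neg_le_abs s)
      nlinarith
    · refine lt_of_lt_of_le ?_ (le_abs_self s)
      nlinarith
  have hle := le_abs_self n
  have hb : 1 < r ^ 2 - n := by nlinarith
  have hbc : r ^ 2 - n + 1 + 2 * r < s ^ 2 - n := by nlinarith
  refine ⟨1, r ^ 2 - n, s ^ 2 - n, by nlinarith, ⟨by lia, by lia, by lia, by lia, by lia, by lia,
    ⟨r, by ring⟩, ⟨s, by ring⟩,
    ⟨(2 * r * k - 1) * (r ^ 2 - n + r) + 2 * k * (r ^ 2 - n) * (r + 1), ?_⟩⟩, ?_, ?_⟩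
  · rw [hs, hr]; ring
  · have : Even (1 + r + s) := ⟨2 * r * (r + 1) * k - r, by rw [hs]; ring⟩
    simp only [Int.even_add, Int.even_sub, Int.even_pow] at this ⊢
    tauto
  · intro h
    nlinarith

/-- For every integer `n` there are infinitely many `D(n)`-triples which are also
`D(t)`-triples for some integer `t ≠ n`. -/
theorem infinitely_many_DTriples_with_two_n (n : ℤ) :
    {S : Finset ℤ | ∃ a b c : ℤ, S = {a, b, c} ∧ IsDTriple n a b c ∧
      ∃ t : ℤ, t ≠ n ∧ IsDTriple t a b c}.Infinite := by
  refine Set.infinite_of_forall_exists_lt_mem fun N ↦ ?_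
  obtain ⟨a, b, c, hN, h, heven, hreg⟩ : ∃ a b c : ℤ, N < c ∧ IsDTriple n a b c ∧
      Even (a + b + c) ∧ (a + b - c) ^ 2 ≠ 4 * (a * b + n) := by
    rcases eq_or_ne n 0 with rfl | hn
    · exact exists_irregular_DTriple_zero N
    · exact exists_irregular_DTriple hn N
  exact ⟨{a, b, c}, ⟨a, b, c, rfl, h, h.exists_ne heven hreg⟩, c, by simp, hN⟩
end

section
/- Let n ∈ ℤ and let {a, b, c} be a D(n)-triple in ℤ such that a + b + c is even and such that c ≠ a + b + 2r and c ≠ a + b − 2r for every integer r with r² = ab + n. Set m = ((a + b + c)/2)² − ab − ac − bc. Then {a, b, c} is a D(m)-triple and m ≠ n. -/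
/-- A `D(n)`-triple `{a, b, c}` with `a + b + c` even and
`c ≠ a + b ± 2√(ab + n)` is also a `D(m)`-triple for
`m = ((a + b + c)/2)² − ab − ac − bc`, with `m ≠ n`. -/
theorem DTriple_of_even_sum (n a b c : ℤ) (h : IsDTriple n a b c)
    (heven : Even (a + b + c))
    (hc : ∀ r : ℤ, r ^ 2 = a * b + n → c ≠ a + b + 2 * r ∧ c ≠ a + b - 2 * r) :
    IsDTriple (((a + b + c) / 2) ^ 2 - a * b - a * c - b * c) a b c ∧
      ((a + b + c) / 2) ^ 2 - a * b - a * c - b * c ≠ n := by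
  obtain ⟨s, hs⟩ := heven
  obtain ⟨hab, hac, hbc, ha, hb, hc0, -⟩ := h
  have hdiv : (a + b + c) / 2 = s := by omega
  obtain rfl : c = 2 * s - a - b := by linarith
  rw [hdiv]
  refine ⟨⟨hab, hac, hbc, ha, hb, hc0, ⟨a + b - s, by ring⟩, ⟨s - b, by ring⟩,
    ⟨s - a, by ring⟩⟩, fun hm => ?_⟩
  exact (hc (a + b - s) (by rw [← hm]; ring)).2 (by ring)
end

section
/- Let n ∈ ℤ and let x ∈ ℤ be such that x² − n is odd, greater than 1, and squarefree. Then there exist infinitely many even integers c such that {1, x² − n, c} is a D(n)-triple (so that in particular the sum 1 + (x² − n) + c of its elements is even). -/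
/-- The Pell equation of a positive nonsquare has arbitrarily large solutions with `v` even. -/
theorem exists_large_even_pell {b : ℤ} (hb : 0 < b) (hns : ¬ IsSquare b) (k : ℕ) :
    ∃ u v : ℤ, u ^ 2 - b * v ^ 2 = 1 ∧ Even v ∧ (k : ℤ) < u ∧ (k : ℤ) < v := by
  obtain ⟨p, q, hpq, hp, hq⟩ :
      ∃ p q : ℤ, p ^ 2 - b * q ^ 2 = 1 ∧ 0 < p ∧ 0 < q := by
    obtain ⟨a, ha, hay⟩ := Pell.Solution₁.exists_pos_of_not_isSquare hb hns
    exact ⟨a.x, a.y, a.prop, by omega, hay⟩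
  have double (u v : ℤ) (h : u ^ 2 - b * v ^ 2 = 1) :
      (u ^ 2 + b * v ^ 2) ^ 2 - b * (2 * u * v) ^ 2 = 1 := by
    linear_combination (u ^ 2 - b * v ^ 2 + 1) * h
  have step (u v : ℤ) (hu : 0 < u) (hv : 0 < v) :
      u < u ^ 2 + b * v ^ 2 ∧ v < 2 * u * v := by
    have h1 : 0 < b * v ^ 2 := by positivity
    constructor <;> nlinarith
  induction k with
  | zero =>
    refine ⟨p ^ 2 + b * q ^ 2, 2 * p * q, double p q hpq, ⟨p * q, by ring⟩, ?_, ?_⟩ <;>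
      push_cast <;> positivity
  | succ k ih =>
    obtain ⟨u, v, h, -, hu, hv⟩ := ih
    obtain ⟨h1, h2⟩ := step u v (by omega) (by omega)
    exact ⟨u ^ 2 + b * v ^ 2, 2 * u * v, double u v h, ⟨u * v, by ring⟩,
      by push_cast; omega, by push_cast; omega⟩

/-- If `p, q` are not both zero, then one of `p * u ± q * v` is at least as large
in absolute value as the smaller of `u` and `v`. -/
theorem le_abs_add_or_le_abs_sub {p q u v k : ℤ} (h : p ≠ 0 ∨ q ≠ 0)
    (hu : k ≤ u) (hv : k ≤ v) (hk : 0 ≤ k) :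
    k ≤ |p * u + q * v| ∨ k ≤ |p * u + q * (-v)| := by
  by_contra! hcon
  obtain ⟨h1, h2⟩ := hcon
  rw [abs_lt] at h1 h2
  rcases h with h | h <;> rcases lt_or_gt_of_ne h with h | h <;> nlinarith

/-- A Pell solution with `v` even yields an even extension of `{1, x ^ 2 - n}`. -/
theorem even_and_isDTriple_of_pell {n x u v : ℤ}
    (hodd : Odd (x ^ 2 - n)) (hgt : 1 < x ^ 2 - n)
    (h : u ^ 2 - (x ^ 2 - n) * v ^ 2 = 1) (hv : Even v)
    (hc : ((x + 1) * u + (x + (x ^ 2 - n)) * v) ^ 2 - n ≠ 0) :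
    Even (((x + 1) * u + (x + (x ^ 2 - n)) * v) ^ 2 - n) ∧
      IsDTriple n 1 (x ^ 2 - n) (((x + 1) * u + (x + (x ^ 2 - n)) * v) ^ 2 - n) := by
  have hu : Odd u := by
    have h' : Odd (u ^ 2 - (x ^ 2 - n) * v ^ 2) := h ▸ odd_one
    simpa [hv, parity_simps] using h'
  have heven : Even (((x + 1) * u + (x + (x ^ 2 - n)) * v) ^ 2 - n) := by
    have hu' := Int.not_even_iff_odd.mpr hu
    have hodd' := Int.not_even_iff_odd.mpr hodd
    simp only [parity_simps] at hodd' ⊢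
    simp only [hv, hu']
    simp at hodd' ⊢
    rw [← Int.not_even_iff_odd]
    tauto
  refine ⟨heven, hgt.ne, ?_, ?_, one_ne_zero, by omega, hc, ⟨x, by ring⟩,
    ⟨(x + 1) * u + (x + (x ^ 2 - n)) * v, by ring⟩,
    ⟨(x + (x ^ 2 - n)) * u + (x + 1) * (x ^ 2 - n) * v, ?_⟩⟩
  · intro h1
    rw [← h1] at heven
    exact Int.not_even_one heven
  · intro h1
    rw [← h1] at heven
    exact Int.not_even_iff_odd.mpr hodd heven
  · linear_combination (-n * (1 - (x ^ 2 - n))) * h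

/-- If `x² − n` is odd, greater than `1` and squarefree, then there are
infinitely many even integers `c` such that `{1, x² − n, c}` is a `D(n)`-triple. -/
theorem infinitely_many_even_extensions (n x : ℤ)
    (hodd : Odd (x ^ 2 - n)) (hgt : 1 < x ^ 2 - n) (hsf : Squarefree (x ^ 2 - n)) :
    {c : ℤ | Even c ∧ IsDTriple n 1 (x ^ 2 - n) c}.Infinite := by
  have hns : ¬ IsSquare (x ^ 2 - n) := by
    rintro ⟨r, hr⟩
    have hunit := hsf r ⟨1, by rw [hr, mul_one]⟩
    rw [Int.isUnit_iff] at hunit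
    rcases hunit with rfl | rfl <;> omega
  refine Set.infinite_of_forall_exists_gt fun N => ?_
  obtain ⟨u, v, h, hv, hku, hkv⟩ :=
    exists_large_even_pell (by omega) hns (N.natAbs + n.natAbs + 1)
  have key (s : ℤ) (hs : ((N.natAbs + n.natAbs + 1 : ℕ) : ℤ) ≤ |s|) :
      s ^ 2 - n ≠ 0 ∧ N < s ^ 2 - n := by
    have h1 : |s| ≤ s ^ 2 := by
      rw [← sq_abs]
      nlinarith [abs_nonneg s]
    constructor <;> omega
  have hpq : x + 1 ≠ 0 ∨ x + (x ^ 2 - n) ≠ 0 := by omega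
  rcases le_abs_add_or_le_abs_sub hpq hku.le hkv.le (by positivity) with hs | hs
  · exact ⟨_, even_and_isDTriple_of_pell hodd hgt h hv (key _ hs).1, (key _ hs).2⟩
  · exact ⟨_, even_and_isDTriple_of_pell hodd hgt (by rwa [neg_sq]) hv.neg (key _ hs).1,
      (key _ hs).2⟩
end

section
/- Let {2, a, b, c} be a regular quadruple with the property D(−1) in ℤ[i]. Then a + b + c is divisible by 2 in ℤ[i], and, writing n₂ = ((a + b + c)/2)² − ab − ac − bc and n₃ = 2 − a − b − c, the triple {a, b, c} is a D(n)-triple in ℤ[i] for each n ∈ {−1, n₂, n₃}. -/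
local notation "ℤ[i]" => GaussianInt

/-- `{a, b, c}` is a `D(n)`-triple in `ℤ[i]`: three pairwise distinct nonzero
Gaussian integers such that `ab + n`, `ac + n`, `bc + n` are squares in `ℤ[i]`. -/
def IsDTripleZi (n a b c : ℤ[i]) : Prop :=
  a ≠ b ∧ a ≠ c ∧ b ≠ c ∧ a ≠ 0 ∧ b ≠ 0 ∧ c ≠ 0 ∧
    IsSquare (a * b + n) ∧ IsSquare (a * c + n) ∧ IsSquare (b * c + n)

/-- `{2, a, b, c}` is a regular quadruple with the property `D(-1)` in `ℤ[i]`. -/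
def IsRegularQuadruple (a b c : ℤ[i]) : Prop :=
  ((2 : ℤ[i]) ≠ a ∧ (2 : ℤ[i]) ≠ b ∧ (2 : ℤ[i]) ≠ c ∧ a ≠ b ∧ a ≠ c ∧ b ≠ c) ∧
  (a ≠ 0 ∧ b ≠ 0 ∧ c ≠ 0) ∧
  (IsSquare (2 * a - 1) ∧ IsSquare (2 * b - 1) ∧ IsSquare (2 * c - 1) ∧
    IsSquare (a * b - 1) ∧ IsSquare (a * c - 1) ∧ IsSquare (b * c - 1)) ∧
  ∃ r s t : ℤ[i], r ^ 2 = 2 * a - 1 ∧ s ^ 2 = 2 * b - 1 ∧ t ^ 2 = a * b - 1 ∧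
    (c = 2 + a + b - 4 * a * b + 2 * r * s * t ∨
      c = 2 + a + b - 4 * a * b - 2 * r * s * t)

/-- The square roots behind the value `2 - a - b - c`, for the choice of sign `+ 2 * r * s * t`. -/
theorem isSquare_mul_add_of_regular {a b c r s t : ℤ[i]} (hr : r ^ 2 = 2 * a - 1)
    (hs : s ^ 2 = 2 * b - 1) (ht : t ^ 2 = a * b - 1)
    (hc : c = 2 + a + b - 4 * a * b + 2 * r * s * t) :
    IsSquare (a * b + (2 - a - b - c)) ∧ IsSquare (a * c + (2 - a - b - c)) ∧
      IsSquare (b * c + (2 - a - b - c)) := by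
  obtain ⟨I, hI⟩ : ∃ I : ℤ[i], I ^ 2 = -1 := ⟨⟨0, 1⟩, by decide⟩
  subst hc
  refine ⟨⟨r * s - t, ?_⟩, ⟨I * ((a - 1) * s - r * t), ?_⟩, ⟨I * ((b - 1) * r - s * t), ?_⟩⟩
  · linear_combination -s ^ 2 * hr - (2 * a - 1) * hs - ht
  · linear_combination -((a - 1) * s - r * t) ^ 2 * hI + (a - 1) ^ 2 * hs + t ^ 2 * hr +
      (2 * a - 1) * ht
  · linear_combination -((b - 1) * r - s * t) ^ 2 * hI + (b - 1) ^ 2 * hr + t ^ 2 * hs +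
      (2 * b - 1) * ht

/-- If `{2, a, b, c}` is a regular `D(-1)`-quadruple in `ℤ[i]`, then `2 ∣ a + b + c`,
and `{a, b, c}` is a `D(n)`-triple for each of `n = -1`,
`n₂ = ((a + b + c)/2)² − ab − ac − bc` and `n₃ = 2 − a − b − c`. -/
theorem regular_quadruple_gives_three_n (a b c : ℤ[i]) (h : IsRegularQuadruple a b c) :
    (2 : ℤ[i]) ∣ (a + b + c) ∧
    ∀ k : ℤ[i], a + b + c = 2 * k →
      IsDTripleZi (-1) a b c ∧
      IsDTripleZi (k ^ 2 - a * b - a * c - b * c) a b c ∧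
      IsDTripleZi (2 - a - b - c) a b c := by
  obtain ⟨⟨-, -, -, hab, hac, hbc⟩, ⟨ha, hb, hc⟩, ⟨-, -, -, qab, qac, qbc⟩,
    r, s, t, hr, hs, ht, h⟩ := h
  obtain ⟨t, ht, h⟩ : ∃ t : ℤ[i], t ^ 2 = a * b - 1 ∧
      c = 2 + a + b - 4 * a * b + 2 * r * s * t := by
    rcases h with h | h
    · exact ⟨t, ht, h⟩
    · exact ⟨-t, by rw [neg_sq, ht], by rw [h]; ring⟩
  refine ⟨⟨1 + a + b - 2 * a * b + r * s * t, by rw [h]; ring⟩, fun k hk => ⟨?_, ?_, ?_⟩⟩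
  · exact ⟨hab, hac, hbc, ha, hb, hc, by rwa [← sub_eq_add_neg], by rwa [← sub_eq_add_neg],
      by rwa [← sub_eq_add_neg]⟩
  · exact ⟨hab, hac, hbc, ha, hb, hc, ⟨k - c, by linear_combination -c * hk⟩,
      ⟨k - b, by linear_combination -b * hk⟩, ⟨k - a, by linear_combination -a * hk⟩⟩
  · exact ⟨hab, hac, hbc, ha, hb, hc, isSquare_mul_add_of_regular hr hs ht h⟩
end

section
/- Let {2, a, b, c} be a regular quadruple with the property D(−1) in ℤ[i], and write n₂ = ((a + b + c)/2)² − ab − ac − bc and n₃ = 2 − a − b − c (here a + b + c is divisible by 2 in ℤ[i]). Then the three values −1, n₂ and n₃ are pairwise distinct; in particular n₂ ≠ −1 and n₃ ≠ −1. -/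
local notation "ℤ[i]" => GaussianInt

set_option maxHeartbeats 1000000 in
/-- The Gaussian integer points on `m ^ 2 - 4 * m - 4 = w ^ 2`. -/
lemma GaussianInt.eq_of_sq_sub_four_mul_sub_four_eq_sq {m w : GaussianInt}
    (h : m ^ 2 - 4 * m - 4 = w ^ 2) :
    (m.re = 4 ∧ m.im = 0 ∧ w.re = 0 ∧ (w.im = 2 ∨ w.im = -2)) ∨
    (m.re = 0 ∧ m.im = 0) ∨
    (m.re = 5 ∧ m.im = 0 ∧ (w.re = 1 ∨ w.re = -1) ∧ w.im = 0) ∨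
    (m.re = -1 ∧ m.im = 0 ∧ (w.re = 1 ∨ w.re = -1) ∧ w.im = 0) ∨
    (m.re = 2 ∧ m.im = 1 ∧ w.re = 0 ∧ (w.im = 3 ∨ w.im = -3)) ∨
    (m.re = 2 ∧ m.im = -1 ∧ w.re = 0 ∧ (w.im = 3 ∨ w.im = -3)) := by
  obtain ⟨m₁, m₂⟩ := m
  obtain ⟨w₁, w₂⟩ := w
  simp only [Zsqrtd.ext_iff, pow_two, Zsqrtd.re_sub, Zsqrtd.im_sub, Zsqrtd.re_mul,
    Zsqrtd.im_mul, Zsqrtd.re_ofNat, Zsqrtd.im_ofNat] at h ⊢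
  obtain ⟨hre, him⟩ := h
  push_cast at hre him
  obtain ⟨x, hx⟩ : ∃ x, x = m₁ - 2 - w₁ := ⟨_, rfl⟩
  obtain ⟨y, hy⟩ : ∃ y, y = m₂ - w₂ := ⟨_, rfl⟩
  obtain ⟨z, hz⟩ : ∃ z, z = m₁ - 2 + w₁ := ⟨_, rfl⟩
  obtain ⟨t, ht⟩ : ∃ t, t = m₂ + w₂ := ⟨_, rfl⟩
  have h₁ : x * z - y * t = 8 := by subst x y z t; linarith
  have h₂ : x * t + y * z = 0 := by subst x y z t; linarith
  have hz' : (x * x + y * y) * z = 8 * x := by linear_combination x * h₁ + y * h₂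
  have ht' : (x * x + y * y) * t = -8 * y := by linear_combination x * h₂ - y * h₁
  have hn : (x * x + y * y) * (z * z + t * t) = 64 := by
    linear_combination (x * z - y * t + 8) * h₁ + (x * t + y * z) * h₂
  have hle : x * x + y * y ≤ 64 := Int.le_of_dvd (by norm_num) ⟨_, hn.symm⟩
  have hx₁ : -8 ≤ x := by nlinarith
  have hx₂ : x ≤ 8 := by nlinarith
  have hy₁ : -8 ≤ y := by nlinarith
  have hy₂ : y ≤ 8 := by nlinarith
  clear hle hn h₂ hre him
  interval_cases x <;> interval_cases y <;> omega

/-- Two distinct nonzero Gaussian integers `a`, `b` with `a * b = (m + 1) ^ 2 - 3 + 2 * (a + b)`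
cannot satisfy `2 * m * (a * b - 1) + (a + b) * (a * b - 2) + 2 = 0`. -/
lemma GaussianInt.two_mul_add_mul_add_two_ne_zero {a b m : GaussianInt} (ha : a ≠ 0) (hb : b ≠ 0)
    (hab : a ≠ b) (hp : a * b = (m + 1) ^ 2 - 3 + 2 * (a + b)) :
    2 * m * (a * b - 1) + (a + b) * (a * b - 2) + 2 ≠ 0 := by
  intro h
  obtain ⟨s, hs⟩ : ∃ s, s = a + b := ⟨_, rfl⟩
  rw [hp, ← hs] at h
  rw [← hs] at hp
  have hdisc : (4 * s + (m ^ 2 + 6 * m - 4)) ^ 2 = m ^ 2 * (m ^ 2 - 4 * m - 4) := by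
    linear_combination 8 * h
  rcases eq_or_ne m 0 with rfl | hm
  · have hs₁ : s = 1 := by
      have : (s - 1) ^ 2 = 0 := by
        refine mul_left_cancel₀ (two_ne_zero (α := GaussianInt)) ?_
        linear_combination h
      exact sub_eq_zero.mp (pow_eq_zero_iff two_ne_zero |>.mp this)
    subst hs₁
    exact mul_ne_zero ha hb (by linear_combination hp)
  obtain ⟨w, hw⟩ : m ∣ 4 * s + (m ^ 2 + 6 * m - 4) :=
    (UniqueFactorizationMonoid.pow_dvd_pow_iff_dvd two_ne_zero).mp ⟨_, hdisc⟩
  have hmw : m ^ 2 - 4 * m - 4 = w ^ 2 := by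
    refine mul_left_cancel₀ (pow_ne_zero 2 hm) ?_
    rw [← hdisc, hw]
    ring
  have hd : (a - b) ^ 2 = s ^ 2 - 4 * ((m + 1) ^ 2 - 3 + 2 * s) := by
    rw [← hp, hs]
    ring
  have hab' : a - b ≠ 0 := sub_ne_zero.mpr hab
  obtain ⟨d, hd'⟩ : ∃ d, d = a - b := ⟨_, rfl⟩
  rw [← hd'] at hd hab'
  have hcases := GaussianInt.eq_of_sq_sub_four_mul_sub_four_eq_sq hmw
  clear hd' hmw hdisc h hp hs hab
  obtain ⟨m₁, m₂⟩ := m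
  obtain ⟨w₁, w₂⟩ := w
  obtain ⟨s₁, s₂⟩ := s
  obtain ⟨x, y⟩ := d
  simp only [ne_eq, Zsqrtd.ext_iff, pow_two, Zsqrtd.re_sub, Zsqrtd.im_sub, Zsqrtd.re_mul,
    Zsqrtd.im_mul, Zsqrtd.re_ofNat, Zsqrtd.im_ofNat, Zsqrtd.re_add, Zsqrtd.im_add,
    Zsqrtd.re_one, Zsqrtd.im_one, Zsqrtd.re_zero, Zsqrtd.im_zero] at *
  push_cast at *
  obtain ⟨hw₁, hw₂⟩ := hw
  obtain ⟨hd₁, hd₂⟩ := hd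
  have hnorm : (x * x + y * y) * (x * x + y * y) =
      (x * x + -1 * y * y) * (x * x + -1 * y * y) + (x * y + y * x) * (x * y + y * x) := by ring
  have hsqrt : ∀ n N : ℤ, 0 ≤ n → n * n < N → N < (n + 1) * (n + 1) →
      (x * x + y * y) * (x * x + y * y) ≠ N := by
    rintro n N hn h₁ h₂ rfl
    have h₃ : 0 ≤ x * x + y * y := add_nonneg (mul_self_nonneg x) (mul_self_nonneg y)
    have h₄ := lt_of_mul_self_lt_mul_self₀ h₃ h₁
    have h₅ := lt_of_mul_self_lt_mul_self₀ (by omega) h₂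
    omega
  rcases hcases with ⟨rfl, rfl, rfl, rfl | rfl⟩ | ⟨rfl, rfl⟩ | ⟨rfl, rfl, rfl | rfl, rfl⟩ |
    ⟨rfl, rfl, rfl | rfl, rfl⟩ | ⟨rfl, rfl, rfl, rfl | rfl⟩ | ⟨rfl, rfl, rfl, rfl | rfl⟩
  all_goals try omega
  · obtain ⟨rfl, rfl⟩ : s₁ = -9 ∧ s₂ = 2 := by omega
    exact hsqrt 80 6425 (by norm_num) (by norm_num) (by norm_num) (by rw [hnorm, hd₁, hd₂]; norm_num)
  · obtain ⟨rfl, rfl⟩ : s₁ = -9 ∧ s₂ = -2 := by omega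
    exact hsqrt 80 6425 (by norm_num) (by norm_num) (by norm_num) (by rw [hnorm, hd₁, hd₂]; norm_num)
  · obtain ⟨rfl, rfl⟩ : s₁ = -14 ∧ s₂ = 0 := by omega
    have hxy : x * y = 0 := by linarith
    rcases mul_eq_zero.mp hxy with rfl | rfl
    · nlinarith
    · have hx : x * x = 176 := by linarith
      have h₁ : x < 14 := by nlinarith
      have h₂ : -14 < x := by nlinarith
      interval_cases x <;> omega
  · obtain ⟨rfl, rfl⟩ : s₁ = 2 ∧ s₂ = 0 := by omega
    have hxy : x * y = 0 := by linarith
    refine hab' ?_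
    rcases mul_eq_zero.mp hxy with rfl | rfl
    · exact ⟨rfl, mul_self_eq_zero.mp (by linarith)⟩
    · exact ⟨mul_self_eq_zero.mp (by linarith), rfl⟩
  · obtain ⟨rfl, rfl⟩ : s₁ = -2 ∧ s₂ = -4 := by omega
    exact hsqrt 28 832 (by norm_num) (by norm_num) (by norm_num) (by rw [hnorm, hd₁, hd₂]; norm_num)
  · obtain ⟨rfl, rfl⟩ : s₁ = -2 ∧ s₂ = 4 := by omega
    exact hsqrt 28 832 (by norm_num) (by norm_num) (by norm_num) (by rw [hnorm, hd₁, hd₂]; norm_num)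

/-- For a regular `D(-1)`-quadruple `{2, a, b, c}` in `ℤ[i]`, the values `-1`,
`n₂ = ((a + b + c)/2)² − ab − ac − bc` and `n₃ = 2 − a − b − c` are pairwise
distinct. -/
theorem regular_quadruple_three_n_distinct (a b c : ℤ[i]) (h : IsRegularQuadruple a b c) :
    (2 : ℤ[i]) ∣ (a + b + c) ∧
    ∀ k : ℤ[i], a + b + c = 2 * k →
      k ^ 2 - a * b - a * c - b * c ≠ -1 ∧
      (2 : ℤ[i]) - a - b - c ≠ -1 ∧
      k ^ 2 - a * b - a * c - b * c ≠ 2 - a - b - c := by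
  obtain ⟨⟨-, -, -, hab, -, -⟩, ⟨ha, hb, -⟩, -, r, s, t, hr, hs, ht, hc⟩ := h
  have two_ne : (2 : ℤ[i]) ≠ 0 := two_ne_zero
  have two_not_dvd_one : ¬ (2 : ℤ[i]) ∣ 1 := by
    rintro ⟨z, hz⟩
    have := congrArg Zsqrtd.re hz
    simp only [Zsqrtd.re_mul, Zsqrtd.re_ofNat, Zsqrtd.im_ofNat, Zsqrtd.re_one] at this
    push_cast at this
    omega
  have hsq : (c - (2 + a + b - 4 * a * b)) ^ 2 =
      4 * (2 * a - 1) * (2 * b - 1) * (a * b - 1) := by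
    rw [← hr, ← hs, ← ht]
    rcases hc with rfl | rfl <;> ring
  refine ⟨?_, fun k hk => ?_⟩
  · rcases hc with rfl | rfl
    · exact ⟨1 + a + b - 2 * a * b + r * s * t, by ring⟩
    · exact ⟨1 + a + b - 2 * a * b - r * s * t, by ring⟩
  obtain rfl : c = 2 * k - a - b := by linear_combination hk
  have hn : k ^ 2 - a * b - a * (2 * k - a - b) - b * (2 * k - a - b) =
      2 * (-(k - a - b) * (2 * (a * b) - 1) - (a + b) * (a * b - 1) - 1) := by
    refine mul_left_cancel₀ (mul_ne_zero two_ne two_ne) ?_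
    linear_combination hsq
  refine ⟨fun h => ?_, fun h => ?_, fun h => ?_⟩
  · rw [hn] at h
    exact two_not_dvd_one ((dvd_neg).mp ⟨_, h.symm⟩)
  · exact two_not_dvd_one ⟨k - 1, by linear_combination h⟩
  · refine GaussianInt.two_mul_add_mul_add_two_ne_zero (m := k - a - b) ha hb hab ?_ ?_
    · linear_combination -h
    · refine mul_left_cancel₀ two_ne ?_
      linear_combination hn - h
end

section
/- Let m ∈ ℤ[i] with m ≠ −1, and set a = 2m² + 2m + 1, b = 2m² + 6m + 5 and c = −32m⁴ − 128m³ − 184m² − 112m − 24. If 2, a, b, c are pairwise distinct, then {2, a, b, c} is a regular quadruple with the property D(−1) in ℤ[i]; in particular 2a − 1 = (2m + 1)², 2b − 1 = (2m + 3)², ab − 1 = (2(m + 1)²)², 2c − 1 = (i(8m² + 16m + 7))², and c = 2 + a + b − 4ab − 2(2m + 1)(2m + 3)(2(m + 1)²). -/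
local notation "ℤ[i]" => GaussianInt

theorem GaussianInt.sqrtd_sq : (Zsqrtd.sqrtd : ℤ[i]) ^ 2 = -1 := by
  rw [sq]
  decide

theorem GaussianInt.two_mul_add_one_ne_zero (z : ℤ[i]) : 2 * z + 1 ≠ 0 := by
  intro h
  have h' := congrArg Zsqrtd.re h
  simp at h'
  omega

/-- For `m ≠ -1`, with `a = 2m² + 2m + 1`, `b = 2m² + 6m + 5` and
`c = −32m⁴ − 128m³ − 184m² − 112m − 24`, if `2, a, b, c` are pairwise distinct,
then `{2, a, b, c}` is a regular `D(-1)`-quadruple in `ℤ[i]`. -/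
theorem family_regular_quadruple (m : ℤ[i]) (hm : m ≠ -1)
    (hdist : (2 : ℤ[i]) ≠ 2 * m ^ 2 + 2 * m + 1 ∧
      (2 : ℤ[i]) ≠ 2 * m ^ 2 + 6 * m + 5 ∧
      (2 : ℤ[i]) ≠ -32 * m ^ 4 - 128 * m ^ 3 - 184 * m ^ 2 - 112 * m - 24 ∧
      2 * m ^ 2 + 2 * m + 1 ≠ 2 * m ^ 2 + 6 * m + 5 ∧
      2 * m ^ 2 + 2 * m + 1 ≠ -32 * m ^ 4 - 128 * m ^ 3 - 184 * m ^ 2 - 112 * m - 24 ∧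
      2 * m ^ 2 + 6 * m + 5 ≠ -32 * m ^ 4 - 128 * m ^ 3 - 184 * m ^ 2 - 112 * m - 24) :
    IsRegularQuadruple (2 * m ^ 2 + 2 * m + 1) (2 * m ^ 2 + 6 * m + 5)
      (-32 * m ^ 4 - 128 * m ^ 3 - 184 * m ^ 2 - 112 * m - 24) ∧
    2 * (2 * m ^ 2 + 2 * m + 1) - 1 = (2 * m + 1) ^ 2 ∧
    2 * (2 * m ^ 2 + 6 * m + 5) - 1 = (2 * m + 3) ^ 2 ∧
    (2 * m ^ 2 + 2 * m + 1) * (2 * m ^ 2 + 6 * m + 5) - 1 = (2 * (m + 1) ^ 2) ^ 2 ∧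
    2 * (-32 * m ^ 4 - 128 * m ^ 3 - 184 * m ^ 2 - 112 * m - 24) - 1 =
      ((Zsqrtd.sqrtd : ℤ[i]) * (8 * m ^ 2 + 16 * m + 7)) ^ 2 ∧
    -32 * m ^ 4 - 128 * m ^ 3 - 184 * m ^ 2 - 112 * m - 24 =
      2 + (2 * m ^ 2 + 2 * m + 1) + (2 * m ^ 2 + 6 * m + 5)
        - 4 * (2 * m ^ 2 + 2 * m + 1) * (2 * m ^ 2 + 6 * m + 5)
        - 2 * (2 * m + 1) * (2 * m + 3) * (2 * (m + 1) ^ 2) := by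
  have hi := GaussianInt.sqrtd_sq
  have h2c : 2 * (-32 * m ^ 4 - 128 * m ^ 3 - 184 * m ^ 2 - 112 * m - 24) - 1 =
      ((Zsqrtd.sqrtd : ℤ[i]) * (8 * m ^ 2 + 16 * m + 7)) ^ 2 := by
    linear_combination (-(8 * m ^ 2 + 16 * m + 7) ^ 2) * hi
  refine ⟨⟨hdist, ⟨?_, ?_, ?_⟩, ⟨⟨2 * m + 1, by ring⟩, ⟨2 * m + 3, by ring⟩,
    ⟨_, h2c.trans (sq _)⟩, ⟨2 * (m + 1) ^ 2, by ring⟩, ?_, ?_⟩,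
    2 * m + 1, 2 * m + 3, 2 * (m + 1) ^ 2, by ring, by ring, by ring, Or.inr (by ring)⟩,
    by ring, by ring, by ring, h2c, by ring⟩
  · convert GaussianInt.two_mul_add_one_ne_zero (m ^ 2 + m) using 1
    ring
  · convert GaussianInt.two_mul_add_one_ne_zero (m ^ 2 + 3 * m + 2) using 1
    ring
  · have hx : m + 1 ≠ 0 := fun h => hm (eq_neg_of_add_eq_zero_left h)
    have h8 : (-8 : ℤ[i]) ≠ 0 := by decide
    convert mul_ne_zero (mul_ne_zero h8 (pow_ne_zero 2 hx))
      (mul_ne_zero (GaussianInt.two_mul_add_one_ne_zero m)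
        (GaussianInt.two_mul_add_one_ne_zero (m + 1))) using 1
    ring
  · refine ⟨Zsqrtd.sqrtd * ((2 * m ^ 2 + 2 * m + 1) * (2 * m + 3) +
      (2 * m + 1) * (2 * (m + 1) ^ 2)), ?_⟩
    linear_combination (-((2 * m ^ 2 + 2 * m + 1) * (2 * m + 3) +
      (2 * m + 1) * (2 * (m + 1) ^ 2)) ^ 2) * hi
  · refine ⟨Zsqrtd.sqrtd * ((2 * m ^ 2 + 6 * m + 5) * (2 * m + 1) +
      (2 * m + 3) * (2 * (m + 1) ^ 2)), ?_⟩
    linear_combination (-((2 * m ^ 2 + 6 * m + 5) * (2 * m + 1) +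
      (2 * m + 3) * (2 * (m + 1) ^ 2)) ^ 2) * hi
end

section
/- Let m ∈ ℤ[i] and set a = 2m² + 2m + 1, b = 2m² + 6m + 5, c = −32m⁴ − 128m³ − 184m² − 112m − 24. Then for each of the three values n₁ = −1, n₂ = 32m⁴ + 128m³ + 180m² + 104m + 20 and n₃ = 256m⁸ + 2048m⁷ + 7104m⁶ + 13952m⁵ + 16992m⁴ + 13184m³ + 6396m² + 1784m + 220, all three of ab + nᵢ, ac + nᵢ and bc + nᵢ are squares in ℤ[i]. In particular, whenever a, b, c are pairwise distinct and nonzero, {a, b, c} is a D(n)-triple in ℤ[i] for n = n₁, n₂, n₃. -/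
local notation "ℤ[i]" => GaussianInt

/-- The negative of a square is a square in the Gaussian integers, since `-1 = i²`. -/
theorem GaussianInt.isSquare_neg_sq (r : GaussianInt) : IsSquare (-r ^ 2) := by
  have hi : (⟨0, 1⟩ : GaussianInt) * ⟨0, 1⟩ = -1 := by decide
  exact ⟨⟨0, 1⟩ * r, by linear_combination (-r ^ 2) * hi⟩

/-- For `a = 2m² + 2m + 1`, `b = 2m² + 6m + 5`,
`c = −32m⁴ − 128m³ − 184m² − 112m − 24`, and each of
`n₁ = −1`, `n₂ = 32m⁴ + 128m³ + 180m² + 104m + 20`,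
`n₃ = 256m⁸ + 2048m⁷ + 7104m⁶ + 13952m⁵ + 16992m⁴ + 13184m³ + 6396m² + 1784m + 220`,
all of `ab + nᵢ`, `ac + nᵢ`, `bc + nᵢ` are squares in `ℤ[i]`. -/
theorem family_triple_three_n (m : ℤ[i]) :
    (∀ n ∈ ({-1,
        32 * m ^ 4 + 128 * m ^ 3 + 180 * m ^ 2 + 104 * m + 20,
        256 * m ^ 8 + 2048 * m ^ 7 + 7104 * m ^ 6 + 13952 * m ^ 5 + 16992 * m ^ 4 +
          13184 * m ^ 3 + 6396 * m ^ 2 + 1784 * m + 220} : Set ℤ[i]),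
      IsSquare ((2 * m ^ 2 + 2 * m + 1) * (2 * m ^ 2 + 6 * m + 5) + n) ∧
      IsSquare ((2 * m ^ 2 + 2 * m + 1) *
        (-32 * m ^ 4 - 128 * m ^ 3 - 184 * m ^ 2 - 112 * m - 24) + n) ∧
      IsSquare ((2 * m ^ 2 + 6 * m + 5) *
        (-32 * m ^ 4 - 128 * m ^ 3 - 184 * m ^ 2 - 112 * m - 24) + n)) ∧
    (2 * m ^ 2 + 2 * m + 1 ≠ 2 * m ^ 2 + 6 * m + 5 →
     2 * m ^ 2 + 2 * m + 1 ≠ -32 * m ^ 4 - 128 * m ^ 3 - 184 * m ^ 2 - 112 * m - 24 →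
     2 * m ^ 2 + 6 * m + 5 ≠ -32 * m ^ 4 - 128 * m ^ 3 - 184 * m ^ 2 - 112 * m - 24 →
     2 * m ^ 2 + 2 * m + 1 ≠ 0 → 2 * m ^ 2 + 6 * m + 5 ≠ 0 →
     -32 * m ^ 4 - 128 * m ^ 3 - 184 * m ^ 2 - 112 * m - 24 ≠ 0 →
     ∀ n ∈ ({-1,
        32 * m ^ 4 + 128 * m ^ 3 + 180 * m ^ 2 + 104 * m + 20,
        256 * m ^ 8 + 2048 * m ^ 7 + 7104 * m ^ 6 + 13952 * m ^ 5 + 16992 * m ^ 4 +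
          13184 * m ^ 3 + 6396 * m ^ 2 + 1784 * m + 220} : Set ℤ[i]),
      IsDTripleZi n (2 * m ^ 2 + 2 * m + 1) (2 * m ^ 2 + 6 * m + 5)
        (-32 * m ^ 4 - 128 * m ^ 3 - 184 * m ^ 2 - 112 * m - 24)) := by
  have neg_square (x r : GaussianInt) (h : x = -r ^ 2) : IsSquare x :=
    h ▸ GaussianInt.isSquare_neg_sq r
  refine (fun h => ⟨h, fun hab hac hbc ha hb hc n hn =>
    ⟨hab, hac, hbc, ha, hb, hc, h n hn⟩⟩) ?_
  rintro n (rfl | rfl | rfl)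
  · exact ⟨⟨2 * m ^ 2 + 4 * m + 2, by ring⟩,
      neg_square _ (8 * m ^ 3 + 20 * m ^ 2 + 16 * m + 5) (by ring),
      neg_square _ (8 * m ^ 3 + 28 * m ^ 2 + 32 * m + 11) (by ring)⟩
  · exact ⟨⟨6 * m ^ 2 + 12 * m + 5, by ring⟩,
      neg_square _ (8 * m ^ 3 + 20 * m ^ 2 + 14 * m + 2) (by ring),
      neg_square _ (8 * m ^ 3 + 28 * m ^ 2 + 30 * m + 10) (by ring)⟩
  · exact ⟨⟨16 * m ^ 4 + 64 * m ^ 3 + 94 * m ^ 2 + 60 * m + 15, by ring⟩,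
      ⟨16 * m ^ 4 + 64 * m ^ 3 + 92 * m ^ 2 + 58 * m + 14, by ring⟩,
      ⟨16 * m ^ 4 + 64 * m ^ 3 + 92 * m ^ 2 + 54 * m + 10, by ring⟩⟩
end

section
/- Let m ∈ ℤ[i] with m ∉ {0, −i, −1, −1 − i}, and set a = 2m(m + i), b = 2(m + 1)(m + 1 + i) and c = −32m⁴ + (−64 − 64i)m³ + (8 − 96i)m² + (40 − 24i)m + 8 + 4i. Then for each of the three values n₀ = −1, n₁ = (2m + 1 + i)²·(8m³ + (8 + 12i)m² + (−4 + 8i)m − 1)·(8m³ + (16 + 12i)m² + (4 + 16i)m − 3 + 4i) and n₂ = (2m + 1 + i)²·(8m² + (8 + 8i)m − 3 + 4i), all three of ab + n, ac + n and bc + n are squares in ℤ[i]; in particular, whenever a, b, c are pairwise distinct, {a, b, c} is a D(n)-triple in ℤ[i] for n = n₀, n₁, n₂. -/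
local notation "ℤ[i]" => GaussianInt

/-- The imaginary unit `i` in `ℤ[i]`. -/
def gi : ℤ[i] := Zsqrtd.sqrtd

theorem gi_sq : gi ^ 2 = -1 := by
  decide

/-- The third element of the family is never zero, since it is `4` times an odd Gaussian integer. -/
theorem quartic_family_ne_zero (m : ℤ[i]) :
    -32 * m ^ 4 + (-64 - 64 * gi) * m ^ 3 + (8 - 96 * gi) * m ^ 2 +
      (40 - 24 * gi) * m + 8 + 4 * gi ≠ 0 := by
  intro h
  have hfactor : -32 * m ^ 4 + (-64 - 64 * gi) * m ^ 3 + (8 - 96 * gi) * m ^ 2 +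
      (40 - 24 * gi) * m + 8 + 4 * gi =
      (4 : ℤ) * ((2 : ℤ) * (-4 * m ^ 4 + (-8 - 8 * gi) * m ^ 3 + (1 - 12 * gi) * m ^ 2 +
        (5 - 3 * gi) * m + 1) + gi) := by
    push_cast
    ring
  rw [hfactor] at h
  generalize -4 * m ^ 4 + (-8 - 8 * gi) * m ^ 3 + (1 - 12 * gi) * m ^ 2 +
    (5 - 3 * gi) * m + 1 = x at h
  have him := congrArg Zsqrtd.im h
  rw [Zsqrtd.im_smul, Zsqrtd.im_add, Zsqrtd.im_smul] at him
  simp only [gi, Zsqrtd.im_sqrtd, Zsqrtd.im_zero] at him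
  omega

/-- For `m ∉ {0, −i, −1, −1−i}` and `a = 2m(m + i)`, `b = 2(m + 1)(m + 1 + i)`,
`c = −32m⁴ + (−64 − 64i)m³ + (8 − 96i)m² + (40 − 24i)m + 8 + 4i`, each of
`ab + n`, `ac + n`, `bc + n` is a square in `ℤ[i]` for
`n = −1`, `n = (2m + 1 + i)²(8m³ + (8 + 12i)m² + (−4 + 8i)m − 1)(8m³ + (16 + 12i)m² + (4 + 16i)m − 3 + 4i)`
and `n = (2m + 1 + i)²(8m² + (8 + 8i)m − 3 + 4i)`. -/
theorem family_triple_three_n_complex (m : ℤ[i])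
    (hm : m ∉ ({0, -gi, -1, -1 - gi} : Set ℤ[i])) :
    (∀ n ∈ ({-1,
        (2 * m + 1 + gi) ^ 2 * (8 * m ^ 3 + (8 + 12 * gi) * m ^ 2 + (-4 + 8 * gi) * m - 1) *
          (8 * m ^ 3 + (16 + 12 * gi) * m ^ 2 + (4 + 16 * gi) * m - 3 + 4 * gi),
        (2 * m + 1 + gi) ^ 2 * (8 * m ^ 2 + (8 + 8 * gi) * m - 3 + 4 * gi)} : Set ℤ[i]),
      IsSquare ((2 * m * (m + gi)) * (2 * (m + 1) * (m + 1 + gi)) + n) ∧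
      IsSquare ((2 * m * (m + gi)) *
        (-32 * m ^ 4 + (-64 - 64 * gi) * m ^ 3 + (8 - 96 * gi) * m ^ 2 +
          (40 - 24 * gi) * m + 8 + 4 * gi) + n) ∧
      IsSquare ((2 * (m + 1) * (m + 1 + gi)) *
        (-32 * m ^ 4 + (-64 - 64 * gi) * m ^ 3 + (8 - 96 * gi) * m ^ 2 +
          (40 - 24 * gi) * m + 8 + 4 * gi) + n)) ∧
    (2 * m * (m + gi) ≠ 2 * (m + 1) * (m + 1 + gi) →
     2 * m * (m + gi) ≠ -32 * m ^ 4 + (-64 - 64 * gi) * m ^ 3 + (8 - 96 * gi) * m ^ 2 +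
        (40 - 24 * gi) * m + 8 + 4 * gi →
     2 * (m + 1) * (m + 1 + gi) ≠ -32 * m ^ 4 + (-64 - 64 * gi) * m ^ 3 +
        (8 - 96 * gi) * m ^ 2 + (40 - 24 * gi) * m + 8 + 4 * gi →
     ∀ n ∈ ({-1,
        (2 * m + 1 + gi) ^ 2 * (8 * m ^ 3 + (8 + 12 * gi) * m ^ 2 + (-4 + 8 * gi) * m - 1) *
          (8 * m ^ 3 + (16 + 12 * gi) * m ^ 2 + (4 + 16 * gi) * m - 3 + 4 * gi),
        (2 * m + 1 + gi) ^ 2 * (8 * m ^ 2 + (8 + 8 * gi) * m - 3 + 4 * gi)} : Set ℤ[i]),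
      IsDTripleZi n (2 * m * (m + gi)) (2 * (m + 1) * (m + 1 + gi))
        (-32 * m ^ 4 + (-64 - 64 * gi) * m ^ 3 + (8 - 96 * gi) * m ^ 2 +
          (40 - 24 * gi) * m + 8 + 4 * gi)) := by
  have hi : gi ^ 2 = -1 := gi_sq
  simp only [Set.mem_insert_iff, Set.mem_singleton_iff, not_or] at hm
  obtain ⟨h₁, h₂, h₃, h₄⟩ := hm
  refine and_iff_left_of_imp (fun hsq hab hac hbc n hn => ?_) |>.mpr ?_
  · refine ⟨hab, hac, hbc, ?_, ?_, quartic_family_ne_zero m, hsq n hn⟩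
    · exact mul_ne_zero (mul_ne_zero two_ne_zero h₁) (fun h => h₂ (by linear_combination h))
    · exact mul_ne_zero (mul_ne_zero two_ne_zero (fun h => h₃ (by linear_combination h)))
        (fun h => h₄ (by linear_combination h))
  · intro n hn
    simp only [Set.mem_insert_iff, Set.mem_singleton_iff] at hn
    rcases hn with rfl | rfl | rfl
    · refine ⟨⟨2 * m ^ 2 + (2 + 2 * gi) * m + gi, ?_⟩,
        ⟨8 * gi * m ^ 3 + (-12 + 8 * gi) * m ^ 2 + (-8 - 4 * gi) * m - gi, ?_⟩,
        ⟨8 * gi * m ^ 3 + (-12 + 16 * gi) * m ^ 2 + (-16 + 4 * gi) * m - 4 - 3 * gi, ?_⟩⟩ <;> grind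
    · refine ⟨⟨16 * m ^ 4 + (32 + 32 * gi) * m ^ 3 + (-2 + 48 * gi) * m ^ 2 + (-18 + 14 * gi) * m - 3 - gi, ?_⟩,
        ⟨16 * m ^ 4 + (32 + 32 * gi) * m ^ 3 + (-4 + 48 * gi) * m ^ 2 + (-18 + 12 * gi) * m - 3 - gi, ?_⟩,
        ⟨16 * m ^ 4 + (32 + 32 * gi) * m ^ 3 + (-4 + 48 * gi) * m ^ 2 + (-22 + 12 * gi) * m - 5 - 3 * gi, ?_⟩⟩ <;> grind
    · refine ⟨⟨6 * m ^ 2 + (6 + 6 * gi) * m - 1 + 3 * gi, ?_⟩,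
        ⟨8 * gi * m ^ 3 + (-12 + 8 * gi) * m ^ 2 + (-8 - 6 * gi) * m + 1 - 3 * gi, ?_⟩,
        ⟨8 * gi * m ^ 3 + (-12 + 16 * gi) * m ^ 2 + (-16 + 2 * gi) * m - 3 - 3 * gi, ?_⟩⟩ <;> grind
end

section
/- Let a, b, c, r, s, t ∈ ℤ[i] satisfy r² = 2a − 1, s² = 2b − 1 and t² = ab − 1. Then 8abc + a² − 2ab + b² − 2ac − 2bc + c² − 4a − 4b − 4c + 8 = 0 if and only if c = 2 + a + b − 4ab + 2rst or c = 2 + a + b − 4ab − 2rst. -/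
local notation "ℤ[i]" => GaussianInt

/-- With `r² = 2a − 1`, `s² = 2b − 1`, `t² = ab − 1` in `ℤ[i]`, the equation
`8abc + a² − 2ab + b² − 2ac − 2bc + c² − 4a − 4b − 4c + 8 = 0` holds if and
only if `c = 2 + a + b − 4ab ± 2rst`. -/
theorem e2_vanishes_iff (a b c r s t : ℤ[i])
    (hr : r ^ 2 = 2 * a - 1) (hs : s ^ 2 = 2 * b - 1) (ht : t ^ 2 = a * b - 1) :
    8 * a * b * c + a ^ 2 - 2 * a * b + b ^ 2 - 2 * a * c - 2 * b * c + c ^ 2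
        - 4 * a - 4 * b - 4 * c + 8 = 0 ↔
      (c = 2 + a + b - 4 * a * b + 2 * r * s * t ∨
        c = 2 + a + b - 4 * a * b - 2 * r * s * t) := by
  have factored : 8 * a * b * c + a ^ 2 - 2 * a * b + b ^ 2 - 2 * a * c - 2 * b * c + c ^ 2
        - 4 * a - 4 * b - 4 * c + 8 =
      (c - (2 + a + b - 4 * a * b + 2 * r * s * t)) *
        (c - (2 + a + b - 4 * a * b - 2 * r * s * t)) := by
    have product_sq : (r * s * t) ^ 2 = (2 * a - 1) * (2 * b - 1) * (a * b - 1) := by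
      rw [mul_pow, mul_pow, hr, hs, ht]
    linear_combination 4 * product_sq
  rw [factored, mul_eq_zero, sub_eq_zero, sub_eq_zero]
end

section
/- For every m ∈ ℤ[i] with m ≠ −1, the set {2, 2m² + 2m + 1, 2m² + 6m + 5} is a D(−1)-triple in ℤ[i]; explicitly, 2(2m² + 2m + 1) − 1 = (2m + 1)², 2(2m² + 6m + 5) − 1 = (2m + 3)², and (2m² + 2m + 1)(2m² + 6m + 5) − 1 = (2(m + 1)²)². -/
local notation "ℤ[i]" => GaussianInt

theorem GaussianInt.two_mul_ne_one (x : ℤ[i]) : 2 * x ≠ 1 := by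
  intro h
  have hre := congrArg Zsqrtd.re h
  simp at hre
  omega

/-- For every `m ∈ ℤ[i]` with `m ≠ -1`, `{2, 2m² + 2m + 1, 2m² + 6m + 5}` is a
`D(-1)`-triple in `ℤ[i]`, with the explicit squares
`2(2m² + 2m + 1) − 1 = (2m + 1)²`, `2(2m² + 6m + 5) − 1 = (2m + 3)²` and
`(2m² + 2m + 1)(2m² + 6m + 5) − 1 = (2(m + 1)²)²`. -/
theorem family_Dneg1_triple (m : ℤ[i]) (hm : m ≠ -1) :
    IsDTripleZi (-1) 2 (2 * m ^ 2 + 2 * m + 1) (2 * m ^ 2 + 6 * m + 5) ∧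
    2 * (2 * m ^ 2 + 2 * m + 1) - 1 = (2 * m + 1) ^ 2 ∧
    2 * (2 * m ^ 2 + 6 * m + 5) - 1 = (2 * m + 3) ^ 2 ∧
    (2 * m ^ 2 + 2 * m + 1) * (2 * m ^ 2 + 6 * m + 5) - 1 = (2 * (m + 1) ^ 2) ^ 2 := by
  have hb : 2 * (2 * m ^ 2 + 2 * m + 1) - 1 = (2 * m + 1) ^ 2 := by ring
  have hc : 2 * (2 * m ^ 2 + 6 * m + 5) - 1 = (2 * m + 3) ^ 2 := by ring
  have hbc : (2 * m ^ 2 + 2 * m + 1) * (2 * m ^ 2 + 6 * m + 5) - 1 =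
      (2 * (m + 1) ^ 2) ^ 2 := by ring
  refine ⟨⟨?_, ?_, ?_, two_ne_zero, ?_, ?_, ?_, ?_, ?_⟩, hb, hc, hbc⟩
  · intro h
    exact GaussianInt.two_mul_ne_one (1 - m ^ 2 - m) (by linear_combination h)
  · intro h
    exact GaussianInt.two_mul_ne_one (-m ^ 2 - 3 * m - 1) (by linear_combination h)
  · intro h
    have h4 : (4 : ℤ[i]) * (m + 1) = 0 := by linear_combination -h
    exact hm (eq_neg_of_add_eq_zero_left ((mul_eq_zero.mp h4).resolve_left (by norm_num)))
  · intro h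
    exact GaussianInt.two_mul_ne_one (-m ^ 2 - m) (by linear_combination -h)
  · intro h
    exact GaussianInt.two_mul_ne_one (-m ^ 2 - 3 * m - 2) (by linear_combination -h)
  · exact ⟨2 * m + 1, by linear_combination hb⟩
  · exact ⟨2 * m + 3, by linear_combination hc⟩
  · exact ⟨2 * (m + 1) ^ 2, by linear_combination hbc⟩
end
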